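/- arXiv:1603.06080 — 2 statements merged into one kernel-verified Lean document; each statement's English description precedes it below -/
import Mathlib

section
/- Let w be a permutation, i ≥ 1, d ≥ 0, and ζ = t_{p₁q₁}⋯t_{p_dq_d} ∈ Y_{i,d}(w). Let 1 ≤ a ≤ d and suppose there is no b < a with q_b = q_a. Then m_{p_aq_a}(w_a) = m_{p_aq_a}(w) and m'_{q_ap_a}(w_a) = m'_{q_ap_a}(w), where w_a = w t_{p₁q₁}⋯t_{p_{a−1}q_{a−1}}. -/
open scoped Classical

noncomputable section

/-- Permutations of the positive integers. -/
abbrev PPerm := Equiv.Perm ℕ+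

/-- A permutation fixes all but finitely many points. -/
def HasFinSupp (w : PPerm) : Prop := {k : ℕ+ | w k ≠ k}.Finite

/-- The transposition `t_{pq}`. -/
def tr (p q : ℕ+) : PPerm := Equiv.swap p q

/-- The set of inversions `I(w)`. -/
def invSet (w : PPerm) : Set (ℕ+ × ℕ+) := {x | x.1 < x.2 ∧ w x.2 < w x.1}

/-- The length `ℓ(w)` (number of inversions). -/
def len (w : PPerm) : ℕ := (invSet w).ncard

/-- `m_{pq}(z) = #{r > q : z(p) < z(r) < z(q)}`. -/
def mCnt (z : PPerm) (p q : ℕ+) : ℕ := {r : ℕ+ | q < r ∧ z p < z r ∧ z r < z q}.ncard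

/-- `m'_{qp}(z) = #{r < p : z(p) < z(r) < z(q)}`. -/
def m'Cnt (z : PPerm) (q p : ℕ+) : ℕ := {r : ℕ+ | r < p ∧ z p < z r ∧ z r < z q}.ncard

/-- The list of transpositions `t_{p₁q₁}, …, t_{p_dq_d}`. -/
def trList (d : ℕ) (p q : Fin d → ℕ+) : List PPerm := List.ofFn fun j => tr (p j) (q j)

/-- `w_{j+1} = w t_{p₁q₁} ⋯ t_{p_jq_j}` (so `wSeq w d p q 0 = w₁ = w`). -/
def wSeq (w : PPerm) (d : ℕ) (p q : Fin d → ℕ+) (j : ℕ) : PPerm :=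
  w * ((trList d p q).take j).prod

/-- The defining conditions on a factorization for membership in `X_{i,d}(w)`. -/
def IsXFact (w : PPerm) (i d : ℕ) (p q : Fin d → ℕ+) : Prop :=
  (∀ j, (p j : ℕ) ≤ i ∧ i < (q j : ℕ)) ∧
  (∀ j : Fin d, len (wSeq w d p q (j + 1)) = len (wSeq w d p q j) + 1) ∧
  (∀ j k : Fin d, j < k → wSeq w d p q j (p j) < wSeq w d p q k (p k))

/-- The defining conditions on a factorization for membership in `Y_{i,d}(w)`. -/
def IsYFact (w : PPerm) (i d : ℕ) (p q : Fin d → ℕ+) : Prop :=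
  (∀ j, (p j : ℕ) ≤ i ∧ i < (q j : ℕ)) ∧
  (∀ j : Fin d, len (wSeq w d p q (j + 1)) = len (wSeq w d p q j) + 1) ∧
  (∀ j k : Fin d, j < k → wSeq w d p q k (q k) < wSeq w d p q j (q j))

/-- The set `X_{i,d}(w)`. -/
def XSet (w : PPerm) (i d : ℕ) : Set PPerm :=
  {ζ | ∃ p q : Fin d → ℕ+, ζ = (trList d p q).prod ∧ IsXFact w i d p q}

/-- The set `Y_{i,d}(w)`. -/
def YSet (w : PPerm) (i d : ℕ) : Set PPerm :=
  {ζ | ∃ p q : Fin d → ℕ+, ζ = (trList d p q).prod ∧ IsYFact w i d p q}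

/-- `w ∈ S^{(n)}`, i.e. `w(n+1) < w(n+2) < ⋯`. -/
def InSn (n : ℕ) (w : PPerm) : Prop := ∀ k l : ℕ+, (n : ℕ) < (k : ℕ) → k < l → w k < w l

/-- `x₁^{m-1} x₂^{m-2} ⋯ x_{m-1}`, the Schubert polynomial of the longest element of `S_m`. -/
def schubBase (m : ℕ) : MvPolynomial ℕ+ ℤ :=
  ∏ k ∈ Finset.range m, MvPolynomial.X (k.succPNat) ^ (m - 1 - k)

/-- The defining property of the family of Schubert polynomials `w ↦ 𝔖_w`:
the value on dominant "staircase" permutations, together with the divided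
difference recursion `𝔖_{w s_i} = ∂_i 𝔖_w` whenever `ℓ(w s_i) < ℓ(w)`, stated
in the product form `(x_i - x_{i+1}) · 𝔖_{w s_i} = 𝔖_w - s_i 𝔖_w`. -/
def IsSchubertFamily (S : PPerm → MvPolynomial ℕ+ ℤ) : Prop :=
  (∀ m : ℕ, ∀ w : PPerm, (∀ k : ℕ+, (k : ℕ) ≤ m → (w k : ℕ) = m + 1 - (k : ℕ)) →
      (∀ k : ℕ+, m < (k : ℕ) → w k = k) → S w = schubBase m) ∧
  (∀ w : PPerm, ∀ i : ℕ+, len (w * tr i (i + 1)) < len w →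
      (MvPolynomial.X i - MvPolynomial.X (i + 1)) * S (w * tr i (i + 1)) =
        S w - MvPolynomial.rename (Equiv.swap i (i + 1)) (S w))

/-- The complete homogeneous symmetric polynomial `h_d(x₁, …, x_i)`. -/
def hPoly (i d : ℕ) : MvPolynomial ℕ+ ℤ :=
  ∑ m : Sym (Fin i) d, ((m : Multiset (Fin i)).map fun k => MvPolynomial.X (k.val.succPNat)).prod

/-- The elementary symmetric polynomial `e_d(x₁, …, x_i)`. -/
def ePoly (i d : ℕ) : MvPolynomial ℕ+ ℤ :=
  ∑ s ∈ Finset.powersetCard d (Finset.univ : Finset (Fin i)),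
    ∏ k ∈ s, MvPolynomial.X (k.val.succPNat)

/-- Lexicographic order on permutations. -/
def lexLT (u v : PPerm) : Prop := ∃ k : ℕ+, (∀ l, l < k → u l = v l) ∧ u k < v k

/-- Reverse lexicographic order on permutations. -/
def rlexLT (u v : PPerm) : Prop := ∃ k : ℕ+, (∀ l, k < l → u l = v l) ∧ u k < v k


theorem HasFinSupp.mul_tr {z : PPerm} (hz : HasFinSupp z) (p q : ℕ+) :
    HasFinSupp (z * tr p q) := by
  refine (hz.union (Set.toFinite {p, q})).subset fun k hk => ?_
  by_contra h
  simp only [Set.mem_union, Set.mem_ofPred_eq, Set.mem_insert_iff, Set.mem_singleton_iff,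
    not_or, not_not] at h
  exact hk (by simp [tr, Equiv.swap_apply_of_ne_of_ne h.2.1 h.2.2, h.1])

theorem HasFinSupp.finite_invSet {z : PPerm} (hz : HasFinSupp z) : (invSet z).Finite := by
  obtain ⟨N, hN⟩ := Set.Finite.bddAbove hz
  refine ((Set.finite_Iic N).prod (Set.finite_Iic N)).subset ?_
  rintro ⟨x, y⟩ ⟨hxy, hz'⟩
  dsimp only at hxy hz'
  have fixed : ∀ k, N < k → z k = k := fun k hk => by
    by_contra h
    exact absurd (hN h) (not_le.2 hk)
  have hy : y ≤ N := by
    by_contra! h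
    have hzy := fixed y h
    have hzx : z x = x := z.injective (fixed (z x) (h.trans (hzy ▸ hz')))
    rw [hzy, hzx] at hz'
    exact lt_asymm hxy hz'
  exact ⟨hxy.le.trans hy, hy⟩

/-- An injection from the inversions of `z` to those of `z * tr p q` when `z p < z q`. -/
def invMap (p q : ℕ+) (x : ℕ+ × ℕ+) : ℕ+ × ℕ+ :=
  if tr p q x.1 < tr p q x.2 then (tr p q x.1, tr p q x.2) else x

theorem tr_tr (p q x : ℕ+) : tr p q (tr p q x) = x := Equiv.swap_apply_self p q x

theorem invMap_mem {z : PPerm} {p q : ℕ+} (hpq : p < q) (h : z p < z q) {x : ℕ+ × ℕ+}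
    (hx : x ∈ invSet z) : invMap p q x ∈ invSet (z * tr p q) := by
  obtain ⟨x, y⟩ := x
  obtain ⟨hxy, hz⟩ := hx
  dsimp only at hxy hz
  unfold invMap
  split_ifs with ht
  · exact ⟨ht, by simpa [tr_tr] using hz⟩
  · refine ⟨hxy, ?_⟩
    simp only [tr, Equiv.Perm.mul_apply, Equiv.swap_apply_def] at ht ⊢
    grind

theorem invMap_injOn (z : PPerm) (p q : ℕ+) : Set.InjOn (invMap p q) (invSet z) := by
  rintro ⟨x, y⟩ ⟨hxy, -⟩ ⟨x', y'⟩ ⟨hxy', -⟩ h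
  dsimp only at hxy hxy'
  unfold invMap at h
  have := tr_tr p q
  grind

theorem len_add_card_le {z : PPerm} (hz : HasFinSupp z) {p q : ℕ+} (hpq : p < q)
    (h : z p < z q) (S : Finset (ℕ+ × ℕ+)) (hS : ↑S ⊆ invSet (z * tr p q))
    (hmiss : ∀ x ∈ invSet z, invMap p q x ∉ S) : len z + S.card ≤ len (z * tr p q) := by
  have hfin := hz.finite_invSet
  rw [len, len, ← Set.ncard_coe_finset S, ← (invMap_injOn z p q).ncard_image,
    ← Set.ncard_union_eq _ (hfin.image _) S.finite_toSet]
  · refine Set.ncard_le_ncard (Set.union_subset ?_ hS) (hz.mul_tr p q).finite_invSet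
    rintro _ ⟨x, hx, rfl⟩
    exact invMap_mem hpq h hx
  · rw [Set.disjoint_left]
    rintro _ ⟨x, hx, rfl⟩ hxS
    exact hmiss x hx hxS

theorem invMap_ne_pair {z : PPerm} {p q r : ℕ+} (hpr : p < r) (hrq : r ≤ q) (h : z p < z r)
    {x : ℕ+ × ℕ+} (hx : x ∈ invSet z) : invMap p q x ≠ (p, r) := by
  obtain ⟨x, y⟩ := x
  obtain ⟨hxy, hz⟩ := hx
  dsimp only at hxy hz
  unfold invMap
  simp only [tr, Equiv.swap_apply_def]
  grind

theorem len_lt_len_mul_tr {z : PPerm} (hz : HasFinSupp z) {p q : ℕ+} (hpq : p < q)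
    (h : z p < z q) : len z < len (z * tr p q) := by
  have := len_add_card_le hz hpq h {(p, q)} (by simpa [invSet, tr] using ⟨hpq, h⟩)
    fun x hx => by simpa using invMap_ne_pair hpq le_rfl h hx
  simpa using this

theorem lt_of_len_mul_tr {z : PPerm} (hz : HasFinSupp z) {p q : ℕ+} (hpq : p < q)
    (hl : len (z * tr p q) = len z + 1) : z p < z q := by
  by_contra! h
  have h' : z q < z p := lt_of_le_of_ne h fun e => hpq.ne' (z.injective e)
  have := len_lt_len_mul_tr (hz.mul_tr p q) hpq (by simpa [tr] using h')
  have e : z * tr p q * tr p q = z := by ext x; simp [tr_tr]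
  rw [e] at this
  omega

theorem not_between_of_len_mul_tr {z : PPerm} (hz : HasFinSupp z) {p q : ℕ+} (hpq : p < q)
    (hl : len (z * tr p q) = len z + 1) {r : ℕ+} (hpr : p < r) (hrq : r < q)
    (h1 : z p < z r) (h2 : z r < z q) : False := by
  have h := lt_of_len_mul_tr hz hpq hl
  have := len_add_card_le hz hpq h {(p, q), (p, r)}
    (by
      intro x hx
      have hr : tr p q r = r := Equiv.swap_apply_of_ne_of_ne hpr.ne' hrq.ne
      simp only [Finset.coe_insert, Finset.coe_singleton, Set.mem_insert_iff,
        Set.mem_singleton_iff] at hx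
      rcases hx with rfl | rfl
      · exact ⟨hpq, by simpa [tr] using h⟩
      · exact ⟨hpr, by simpa [hr] using (by simpa [tr] using h2 : z r < z (tr p q p))⟩)
    fun x hx => by
      simpa using ⟨invMap_ne_pair hpq le_rfl h hx, invMap_ne_pair hpr hrq.le h1 hx⟩
  rw [Finset.card_pair (by simpa using hrq.ne')] at this
  omega

theorem wSeq_zero (w : PPerm) (d : ℕ) (p q : Fin d → ℕ+) : wSeq w d p q 0 = w := by
  simp [wSeq]

theorem wSeq_succ (w : PPerm) (d : ℕ) (p q : Fin d → ℕ+) (j : Fin d) :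
    wSeq w d p q (j + 1) = wSeq w d p q j * tr (p j) (q j) := by
  have hj : (j : ℕ) < (trList d p q).length := by simp [trList]
  rw [wSeq, wSeq, List.prod_take_succ _ _ hj, mul_assoc]
  simp [trList]

theorem HasFinSupp.wSeq {w : PPerm} (hw : HasFinSupp w) (d : ℕ) (p q : Fin d → ℕ+) (n : ℕ)
    (hn : n ≤ d) : HasFinSupp (wSeq w d p q n) := by
  induction n with
  | zero => rwa [wSeq_zero]
  | succ n ih =>
    rw [wSeq_succ w d p q ⟨n, hn⟩]
    exact (ih (by omega)).mul_tr _ _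

namespace IsYFact

variable {w : PPerm} {i d : ℕ} {p q : Fin d → ℕ+}

theorem lt (hY : IsYFact w i d p q) (j k : Fin d) : p j < q k :=
  PNat.coe_lt_coe _ _ |>.1 ((hY.1 j).1.trans_lt (hY.1 k).2)

theorem wSeq_lt (hY : IsYFact w i d p q) (hw : HasFinSupp w) (j : Fin d) :
    wSeq w d p q j (p j) < wSeq w d p q j (q j) :=
  lt_of_len_mul_tr (hw.wSeq d p q j j.2.le) (hY.lt j j) (by rw [← wSeq_succ]; exact hY.2.1 j)

theorem not_between (hY : IsYFact w i d p q) (hw : HasFinSupp w) (j : Fin d) {r : ℕ+}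
    (hpr : p j < r) (hrq : r < q j) (h1 : wSeq w d p q j (p j) < wSeq w d p q j r)
    (h2 : wSeq w d p q j r < wSeq w d p q j (q j)) : False :=
  not_between_of_len_mul_tr (hw.wSeq d p q j j.2.le) (hY.lt j j)
    (by rw [← wSeq_succ]; exact hY.2.1 j) hpr hrq h1 h2

theorem wSeq_mono (hY : IsYFact w i d p q) (hw : HasFinSupp w) {x : ℕ+} (hx : (x : ℕ) ≤ i)
    {n m : ℕ} (hnm : n ≤ m) (hm : m ≤ d) : wSeq w d p q n x ≤ wSeq w d p q m x := by
  induction m, hnm using Nat.le_induction with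
  | base => exact le_rfl
  | succ m hnm ih =>
    refine (ih (by omega)).trans ?_
    have hlt := hY.wSeq_lt hw ⟨m, hm⟩
    have hq : x ≠ q ⟨m, hm⟩ := fun e => by
      have := (hY.1 ⟨m, hm⟩).2
      rw [← e] at this
      omega
    rw [wSeq_succ w d p q ⟨m, hm⟩]
    simp only [tr, Equiv.Perm.mul_apply, Equiv.swap_apply_def]
    grind

theorem wSeq_eq {x : ℕ+} {n m : ℕ} (hnm : n ≤ m) (hm : m ≤ d)
    (h : ∀ c : Fin d, n ≤ c → (c : ℕ) < m → wSeq w d p q c x = wSeq w d p q n x →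
      x ≠ p c ∧ x ≠ q c) :
    wSeq w d p q m x = wSeq w d p q n x := by
  induction m, hnm using Nat.le_induction with
  | base => rfl
  | succ m hnm ih =>
    have ih' := ih (by omega) fun c h1 h2 => h c h1 (by omega)
    obtain ⟨hp, hq⟩ := h ⟨m, hm⟩ hnm (Nat.lt_succ_self m) ih'
    rw [wSeq_succ w d p q ⟨m, hm⟩, ← ih']
    simp [tr, Equiv.swap_apply_of_ne_of_ne hp hq]

theorem p_ne (hY : IsYFact w i d p q) (hw : HasFinSupp w) {b a : Fin d} (hba : b < a) :
    p b ≠ p a := by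
  intro e
  have h1 := hY.wSeq_mono hw (hY.1 b).1 (n := b + 1) (m := a) hba a.2.le
  rw [wSeq_succ] at h1
  simp only [tr, Equiv.Perm.mul_apply, Equiv.swap_apply_left] at h1
  rw [e] at h1
  exact lt_irrefl _ ((h1.trans_lt (hY.wSeq_lt hw a)).trans (hY.2.2 b a hba))

theorem wSeq_p (hY : IsYFact w i d p q) (hw : HasFinSupp w) (a : Fin d) {n : ℕ} (hn : n ≤ a) :
    wSeq w d p q a (p a) = wSeq w d p q n (p a) :=
  wSeq_eq hn a.2.le fun c _ hc _ => ⟨(hY.p_ne hw hc).symm, (hY.lt a c).ne⟩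

theorem wSeq_q (hY : IsYFact w i d p q) {a : Fin d} (ha : ∀ b : Fin d, b < a → q b ≠ q a)
    {n : ℕ} (hn : n ≤ a) : wSeq w d p q a (q a) = wSeq w d p q n (q a) :=
  wSeq_eq hn a.2.le fun c _ hc _ => ⟨(hY.lt c a).ne', (ha c hc).symm⟩

theorem between_succ_iff_of_q_lt (hY : IsYFact w i d p q) (hw : HasFinSupp w) {a c : Fin d}
    (ha : ∀ b : Fin d, b < a → q b ≠ q a) (hc : c < a) {r : ℕ+} (hr : q a < r) :
    wSeq w d p q (c + 1) r ∈ Set.Ioo (wSeq w d p q a (p a)) (wSeq w d p q a (q a)) ↔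
      wSeq w d p q c r ∈ Set.Ioo (wSeq w d p q a (p a)) (wSeq w d p q a (q a)) := by
  have hp : r ≠ p c := ((hY.lt c a).trans hr).ne'
  have hv := hY.2.2 c a hc
  rw [wSeq_succ, Equiv.Perm.mul_apply]
  by_cases hq : r = q c
  · subst hq
    refine ⟨fun h => ?_, fun h => absurd hv h.2.not_gt⟩
    simp only [tr, Equiv.swap_apply_right] at h
    have hva := hY.wSeq_q ha hc.le
    exact (hY.not_between hw c (hY.lt c a) hr (hva ▸ h.2) (hva ▸ hv)).elim
  · rw [tr, Equiv.swap_apply_of_ne_of_ne hp hq]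

theorem between_succ_iff_of_lt_p (hY : IsYFact w i d p q) (hw : HasFinSupp w) {a c : Fin d}
    (ha : ∀ b : Fin d, b < a → q b ≠ q a) (hc : c < a) {r : ℕ+} (hr : r < p a) :
    wSeq w d p q (c + 1) r ∈ Set.Ioo (wSeq w d p q a (p a)) (wSeq w d p q a (q a)) ↔
      wSeq w d p q c r ∈ Set.Ioo (wSeq w d p q a (p a)) (wSeq w d p q a (q a)) := by
  have hq : r ≠ q c := (hr.trans (hY.lt a c)).ne
  have hv := hY.2.2 c a hc
  have hva := hY.wSeq_q ha hc.le
  by_cases hp : r = p c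
  · subst hp
    rw [wSeq_succ, Equiv.Perm.mul_apply]
    simp only [tr, Equiv.swap_apply_left]
    refine ⟨fun h => absurd hv h.2.not_gt, fun h => ?_⟩
    rcases lt_or_gt_of_ne (ha c hc) with hlt | hgt
    · have hcur : wSeq w d p q (c + 1) (q c) = wSeq w d p q c (p c) := by
        rw [wSeq_succ, Equiv.Perm.mul_apply, tr, Equiv.swap_apply_right]
      have hconst : wSeq w d p q a (q c) = wSeq w d p q (c + 1) (q c) := by
        refine wSeq_eq hc a.2.le fun e _ hea heq => ⟨(hY.lt e c).ne', fun hqe => ?_⟩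
        have := hY.2.2 e a hea
        rw [← hqe, heq, hcur] at this
        exact lt_asymm this h.2
      rw [← hcur, ← hconst] at h
      exact (hY.not_between hw a (hY.lt a c) hlt h.1 h.2).elim
    · exact (hY.not_between hw c (hY.lt c a) hgt (hva ▸ h.2) (hva ▸ hv)).elim
  · rw [wSeq_succ, Equiv.Perm.mul_apply, tr, Equiv.swap_apply_of_ne_of_ne hp hq]

end IsYFact

theorem wSeq_mem_iff_of_succ {w : PPerm} {d : ℕ} {p q : Fin d → ℕ+} {a : Fin d} {r : ℕ+}
    {S : Set ℕ+} (h : ∀ c : Fin d, c < a → (wSeq w d p q (c + 1) r ∈ S ↔ wSeq w d p q c r ∈ S)) :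
    wSeq w d p q a r ∈ S ↔ w r ∈ S := by
  have key : ∀ n : ℕ, n ≤ a → (wSeq w d p q n r ∈ S ↔ w r ∈ S) := by
    intro n
    induction n with
    | zero => simp [wSeq_zero]
    | succ n ih =>
      intro hn
      exact (h ⟨n, hn.trans a.2.le⟩ hn).trans (ih (by omega))
  exact key a le_rfl

/-- If `ζ = t_{p₁q₁}⋯t_{p_dq_d} ∈ Y_{i,d}(w)` and no `b < a` satisfies `q_b = q_a`,
then `m_{p_aq_a}(w_a) = m_{p_aq_a}(w)` and `m'_{q_ap_a}(w_a) = m'_{q_ap_a}(w)`. -/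
theorem m_invariance_Y (w : PPerm) (hwf : HasFinSupp w) (i d : ℕ) (hi : 1 ≤ i)
    (p q : Fin d → ℕ+) (hY : IsYFact w i d p q) (a : Fin d)
    (ha : ∀ b : Fin d, b < a → q b ≠ q a) :
    mCnt (wSeq w d p q a) (p a) (q a) = mCnt w (p a) (q a) ∧
      m'Cnt (wSeq w d p q a) (q a) (p a) = m'Cnt w (q a) (p a) := by
  have hp : wSeq w d p q a (p a) = w (p a) := by
    rw [hY.wSeq_p hwf a (Nat.zero_le _), wSeq_zero]
  have hq : wSeq w d p q a (q a) = w (q a) := by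
    rw [hY.wSeq_q ha (Nat.zero_le _), wSeq_zero]
  have hm : ∀ r, q a < r → _ := fun r hr =>
    wSeq_mem_iff_of_succ fun c hc => hY.between_succ_iff_of_q_lt hwf ha hc hr
  have hm' : ∀ r, r < p a → _ := fun r hr =>
    wSeq_mem_iff_of_succ fun c hc => hY.between_succ_iff_of_lt_p hwf ha hc hr
  rw [hp, hq] at hm hm'
  unfold mCnt m'Cnt
  rw [hp, hq]
  exact ⟨congrArg Set.ncard (Set.ext fun r => and_congr_right (hm r)),
    congrArg Set.ncard (Set.ext fun r => and_congr_right (hm' r))⟩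

end
end

section
/- Let R₁ = [a₁,b₁] × [c₁,d₁] and R₂ = [a₂,b₂] × [c₂,d₂] be two rectangles in the plane with edges parallel to the coordinate axes (a_k < b_k, c_k < d_k), such that no two edges of the rectangles lie on the same line (i.e. {a₁,b₁} ∩ {a₂,b₂} = ∅ and {c₁,d₁} ∩ {c₂,d₂} = ∅). Call (a_k,c_k) and (b_k,d_k) the NW and SE corners of R_k, and (a_k,d_k) and (b_k,c_k) its NE and SW corners, and say a point lies inside a rectangle if it lies in its open interior. Then #(NW and SE corners of R₁ inside R₂) − #(NE and SW corners of R₁ inside R₂) = #(NW and SE corners of R₂ inside R₁) − #(NE and SW corners of R₂ inside R₁). -/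
open scoped Classical

noncomputable section

/-- A point lies in the open interior of the rectangle `[a,b] × [c,d]`. -/
def InsideRect (a b c d : ℝ) (p : ℝ × ℝ) : Prop :=
  a < p.1 ∧ p.1 < b ∧ c < p.2 ∧ p.2 < d

/-- The number (0, 1 or 2) of the two given points lying inside a rectangle. -/
def cnt2 (a b c d : ℝ) (p₁ p₂ : ℝ × ℝ) : ℤ :=
  (if InsideRect a b c d p₁ then 1 else 0) + (if InsideRect a b c d p₂ then 1 else 0)

/-- The indicator of the open interval `(a, b)`. -/
def indIoo (a b x : ℝ) : ℤ := if a < x ∧ x < b then 1 else 0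

/-- For two intervals with no common endpoint, the signed count of the endpoints of each
inside the other are opposite. -/
theorem indIoo_sub_indIoo {a₁ b₁ a₂ b₂ : ℝ} (h₁ : a₁ < b₁) (h₂ : a₂ < b₂)
    (h : ({a₁, b₁} ∩ {a₂, b₂} : Set ℝ) = ∅) :
    indIoo a₂ b₂ a₁ - indIoo a₂ b₂ b₁ = -(indIoo a₁ b₁ a₂ - indIoo a₁ b₁ b₂) := by
  have hdisj := Set.disjoint_iff_inter_eq_empty.mpr h
  simp only [Set.disjoint_insert_left, Set.disjoint_singleton_left, Set.mem_insert_iff,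
    Set.mem_singleton_iff, not_or] at hdisj
  obtain ⟨⟨haa, hab⟩, hba, hbb⟩ := hdisj
  unfold indIoo
  rcases lt_or_gt_of_ne haa with haa | haa <;> rcases lt_or_gt_of_ne hab with hab | hab <;>
    rcases lt_or_gt_of_ne hba with hba | hba <;> rcases lt_or_gt_of_ne hbb with hbb | hbb <;>
    first
    | (exfalso; linarith)
    | simp [haa, hab, hba, hbb, haa.not_gt, hab.not_gt, hba.not_gt, hbb.not_gt]

/-- The corner count of a rectangle factors as a product of signed endpoint counts. -/
theorem cnt2_sub_cnt2 (a b c d x₁ x₂ y₁ y₂ : ℝ) :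
    cnt2 a b c d (x₁, y₁) (x₂, y₂) - cnt2 a b c d (x₁, y₂) (x₂, y₁) =
      (indIoo a b x₁ - indIoo a b x₂) * (indIoo c d y₁ - indIoo c d y₂) := by
  have h (x y : ℝ) :
      (if InsideRect a b c d (x, y) then 1 else 0 : ℤ) = indIoo a b x * indIoo c d y := by
    simp only [InsideRect, indIoo, ite_zero_mul_ite_zero, and_assoc, mul_one]
    congr
  simp only [cnt2, h]
  ring

/-- For two axis-parallel rectangles `R₁ = [a₁,b₁] × [c₁,d₁]`, `R₂ = [a₂,b₂] × [c₂,d₂]`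
with no two edges on a common line,
`#(NW,SE corners of R₁ inside R₂) − #(NE,SW corners of R₁ inside R₂)
 = #(NW,SE corners of R₂ inside R₁) − #(NE,SW corners of R₂ inside R₁)`,
where the NW and SE corners of `R_k` are `(a_k, c_k)` and `(b_k, d_k)`, and its NE and
SW corners are `(a_k, d_k)` and `(b_k, c_k)`. -/
theorem rectangle_corner_count (a₁ b₁ c₁ d₁ a₂ b₂ c₂ d₂ : ℝ)
    (hab₁ : a₁ < b₁) (hcd₁ : c₁ < d₁) (hab₂ : a₂ < b₂) (hcd₂ : c₂ < d₂)
    (hx : ({a₁, b₁} ∩ {a₂, b₂} : Set ℝ) = ∅) (hy : ({c₁, d₁} ∩ {c₂, d₂} : Set ℝ) = ∅) :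
    cnt2 a₂ b₂ c₂ d₂ (a₁, c₁) (b₁, d₁) - cnt2 a₂ b₂ c₂ d₂ (a₁, d₁) (b₁, c₁) =
      cnt2 a₁ b₁ c₁ d₁ (a₂, c₂) (b₂, d₂) - cnt2 a₁ b₁ c₁ d₁ (a₂, d₂) (b₂, c₂) := by
  rw [cnt2_sub_cnt2, cnt2_sub_cnt2, indIoo_sub_indIoo hab₁ hab₂ hx,
    indIoo_sub_indIoo hcd₁ hcd₂ hy, neg_mul_neg]

end
end
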